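/- arXiv:2505.14290 — 4 statements merged into one kernel-verified Lean document; each statement's English description precedes it below -/
import Mathlib

section
/- Fix a natural number N, real numbers A_j ≥ 0 and B_j ≤ 0, real exponents a_j, b_j for j = 1,…,N, and real parameters α > 1 and p > 1. Assume that a_j ≤ (1−α)/(α·(p−1)) and 0 ≤ b_j ≤ 1 for every j. Define 𝒢 : (0,∞) → ℝ by 𝒢(v) = ∑_{j=1}^N A_j·v^{a_j} + ∑_{j=1}^N B_j·v^{b_j}, where v^{a} denotes the real power. Then for every v > 0, α·(p−1)·v²·𝒢''(v) − (α−1)·(𝒢(v) − v·𝒢'(v)) ≥ 0. -/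
theorem psum_hasDerivAt (N : ℕ) (c e : Fin N → ℝ) (w : ℝ) (hw : 0 < w) :
    HasDerivAt (fun w : ℝ => ∑ j, c j * w ^ (e j)) (∑ j, (c j * e j) * w ^ (e j - 1)) w := by
  apply HasDerivAt.fun_sum
  intro j _
  have h := (Real.hasDerivAt_rpow_const (p := e j) (Or.inl hw.ne')).const_mul (c j)
  rw [← mul_assoc] at h
  exact h

theorem psum_key (N : ℕ) (c e : Fin N → ℝ) (k α v : ℝ) (hv : 0 < v)
    (h : ∀ j, 0 ≤ c j * ((e j - 1) * (k * e j + (α - 1)))) :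
    0 ≤ k * v ^ 2 * (∑ j, (c j * e j * (e j - 1)) * v ^ (e j - 1 - 1))
      - (α - 1) * ((∑ j, c j * v ^ (e j)) - v * ∑ j, (c j * e j) * v ^ (e j - 1)) := by
  simp only [Finset.mul_sum, ← Finset.sum_sub_distrib]
  apply Finset.sum_nonneg
  intro j _
  have h0 := mul_nonneg (h j) (Real.rpow_pos_of_pos hv (e j)).le
  rw [Real.rpow_sub_one hv.ne', Real.rpow_sub_one hv.ne']
  convert h0 using 1
  field_simp
  ring

/-- For the power-sum nonlinearity `𝒢(v) = ∑ Aⱼ v^{aⱼ} + ∑ Bⱼ v^{bⱼ}` with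
`Aⱼ ≥ 0`, `Bⱼ ≤ 0`, `α > 1`, `p > 1`, `aⱼ ≤ (1-α)/(α(p-1))` and `0 ≤ bⱼ ≤ 1`,
one has `α(p-1) v² 𝒢''(v) - (α-1)(𝒢(v) - v 𝒢'(v)) ≥ 0` for every `v > 0`. -/
theorem power_sum_convexity_condition (N : ℕ) (A B a b : Fin N → ℝ)
    (α p : ℝ) (hα : 1 < α) (hp : 1 < p)
    (hA : ∀ j, 0 ≤ A j) (hB : ∀ j, B j ≤ 0)
    (ha : ∀ j, a j ≤ (1 - α) / (α * (p - 1)))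
    (hb : ∀ j, 0 ≤ b j ∧ b j ≤ 1)
    (v : ℝ) (hv : 0 < v) :
    0 ≤ α * (p - 1) * v ^ 2 *
          deriv (deriv (fun w : ℝ => (∑ j, A j * w ^ (a j)) + ∑ j, B j * w ^ (b j))) v
        - (α - 1) *
          (((∑ j, A j * v ^ (a j)) + ∑ j, B j * v ^ (b j))
            - v * deriv (fun w : ℝ => (∑ j, A j * w ^ (a j)) + ∑ j, B j * w ^ (b j)) v) := by
  have h1 : ∀ w : ℝ, 0 < w →
      deriv (fun w : ℝ => (∑ j, A j * w ^ (a j)) + ∑ j, B j * w ^ (b j)) w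
        = (∑ j, (A j * a j) * w ^ (a j - 1)) + ∑ j, (B j * b j) * w ^ (b j - 1) := fun w hw =>
    ((psum_hasDerivAt N A a w hw).add (psum_hasDerivAt N B b w hw)).deriv
  have h2 : deriv (deriv (fun w : ℝ => (∑ j, A j * w ^ (a j)) + ∑ j, B j * w ^ (b j))) v
      = (∑ j, (A j * a j * (a j - 1)) * v ^ (a j - 1 - 1))
        + ∑ j, (B j * b j * (b j - 1)) * v ^ (b j - 1 - 1) := by
    have he : deriv (fun w : ℝ => (∑ j, A j * w ^ (a j)) + ∑ j, B j * w ^ (b j)) =ᶠ[nhds v]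
        fun w => (∑ j, (A j * a j) * w ^ (a j - 1)) + ∑ j, (B j * b j) * w ^ (b j - 1) := by
      filter_upwards [lt_mem_nhds hv] with w hw using h1 w hw
    rw [he.deriv_eq]
    exact ((psum_hasDerivAt N (fun j => A j * a j) (fun j => a j - 1) v hv).add
      (psum_hasDerivAt N (fun j => B j * b j) (fun j => b j - 1) v hv)).deriv
  have hk : 0 < α * (p - 1) := mul_pos (by linarith) (by linarith)
  have kA := psum_key N A a (α * (p - 1)) α v hv (fun j => by
    have h3 := (le_div_iff₀ hk).1 (ha j)
    have h4 : a j < 0 := lt_of_le_of_lt (ha j) (div_neg_of_neg_of_pos (by linarith) hk)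
    exact mul_nonneg (hA j) (mul_nonneg_of_nonpos_of_nonpos (by linarith) (by linarith)))
  have kB := psum_key N B b (α * (p - 1)) α v hv (fun j => by
    have h3 := mul_nonneg hk.le (hb j).1
    exact mul_nonneg_of_nonpos_of_nonpos (hB j)
      (mul_nonpos_of_nonpos_of_nonneg (by linarith [(hb j).2]) (by linarith)))
  rw [h2, h1 v hv]
  linarith
end

section
/- Let γ > 0 and b ≠ 0 be real numbers, and for t > 0 define α(t) = 1 + (cosh(γt)·sinh(γt) − γt)/sinh²(γt) and β(t) = b·γ·(coth(γt) + 1). Then for every t > 0, α and β are differentiable at t and satisfy 2·β(t)/b − α'(t) = 2·α(t)·(β(t)/b − γ) and β'(t) + 2·(β(t)/b − γ)·β(t) − β(t)²/b = 0. -/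
/-- Second example of Remark 2.9: with `γ > 0`, `b ≠ 0`,
`α(t) = 1 + (cosh(γt) sinh(γt) - γt)/sinh²(γt)` and `β(t) = bγ(coth(γt) + 1)`,
for every `t > 0` the functions `α, β` are differentiable at `t` and satisfy
`2β/b - α' = 2α(β/b - γ)` and `β' + 2(β/b - γ)β - β²/b = 0`. -/
theorem harnack_coefficients_hyperbolic (γ b : ℝ) (hγ : 0 < γ) (hb : b ≠ 0)
    (α β : ℝ → ℝ)
    (hα : α = fun t =>
      1 + (Real.cosh (γ * t) * Real.sinh (γ * t) - γ * t) / (Real.sinh (γ * t)) ^ 2)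
    (hβ : β = fun t => b * γ * (Real.cosh (γ * t) / Real.sinh (γ * t) + 1))
    (t : ℝ) (ht : 0 < t) :
    ∃ α' β' : ℝ, HasDerivAt α α' t ∧ HasDerivAt β β' t ∧
      2 * β t / b - α' = 2 * α t * (β t / b - γ) ∧
      β' + 2 * (β t / b - γ) * β t - (β t) ^ 2 / b = 0 := by
  have hs : Real.sinh (γ * t) ≠ 0 := (Real.sinh_pos_iff.mpr (mul_pos hγ ht)).ne'
  have hl : HasDerivAt (fun t : ℝ => γ * t) γ t := by
    simpa using (hasDerivAt_id t).const_mul γ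
  have hS := hl.sinh
  have hC := hl.cosh
  have hA := (((hC.mul hS).sub hl).div (hS.pow 2) (pow_ne_zero 2 hs)).const_add 1
  have hB := ((hC.div hS hs).add_const 1).const_mul (b * γ)
  have hcs := Real.cosh_sq (γ * t)
  subst hα hβ
  refine ⟨_, _, hA, hB, ?_, ?_⟩
  · simp only [Pi.mul_apply, Pi.sub_apply, Pi.pow_apply]
    generalize Real.sinh (γ * t) = s at *
    generalize Real.cosh (γ * t) = c at *
    field_simp
    push_cast
    grind
  · simp only
    generalize Real.sinh (γ * t) = s at *
    generalize Real.cosh (γ * t) = c at *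
    field_simp
    grind
end

section
/- Let E be a real inner product space and let f : E × ℝ → ℝ be continuously differentiable. Let M > 0 be a real constant, let α, h : ℝ → ℝ be continuous with α(t) > 0 for all t, and suppose that for every x ∈ E and every t, −∂_t f(x,t) ≤ (1/α(t))·(h(t) − M·‖∇_x f(x,t)‖²), where ∇_x f(x,t) denotes the gradient of the map y ↦ f(y,t) at x. Then for all real numbers t₁ < t₂, all points x₁, x₂ ∈ E, and every continuously differentiable curve γ : [t₁,t₂] → E with γ(t₁) = x₁ and γ(t₂) = x₂, one has f(x₁,t₁) − f(x₂,t₂) ≤ ∫_{t₁}^{t₂} α(t)·‖γ'(t)‖²/(4M) dt + ∫_{t₁}^{t₂} h(t)/α(t) dt. -/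
/-- Space–time curve integration argument for the Harnack inequality (additive form):
if `f : E × ℝ → ℝ` is `C¹` and `-∂ₜ f(x,t) ≤ (1/α(t))(h(t) - M ‖∇ₓ f(x,t)‖²)`
for all `(x,t)`, then along any `C¹` curve `γ` joining `x₁` at time `t₁` to `x₂`
at time `t₂ > t₁`,
`f(x₁,t₁) - f(x₂,t₂) ≤ ∫ α‖γ'‖²/(4M) + ∫ h/α`. -/
theorem harnack_curve_integration
    {E : Type*} [NormedAddCommGroup E] [InnerProductSpace ℝ E] [CompleteSpace E]
    (f : E × ℝ → ℝ) (hf : ContDiff ℝ 1 f)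
    (M : ℝ) (hM : 0 < M)
    (α h : ℝ → ℝ) (hαc : Continuous α) (hhc : Continuous h)
    (hαpos : ∀ t, 0 < α t)
    (hineq : ∀ (x : E) (t : ℝ),
      -(deriv (fun s => f (x, s)) t)
        ≤ (1 / α t) * (h t - M * ‖gradient (fun y => f (y, t)) x‖ ^ 2))
    (t₁ t₂ : ℝ) (ht : t₁ < t₂) (x₁ x₂ : E)
    (γ γ' : ℝ → E) (hγ₁ : γ t₁ = x₁) (hγ₂ : γ t₂ = x₂)
    (hγderiv : ∀ t ∈ Set.Icc t₁ t₂, HasDerivWithinAt γ (γ' t) (Set.Icc t₁ t₂) t)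
    (hγ'cont : ContinuousOn γ' (Set.Icc t₁ t₂)) :
    f (x₁, t₁) - f (x₂, t₂)
      ≤ (∫ t in t₁..t₂, α t * ‖γ' t‖ ^ 2 / (4 * M))
        + ∫ t in t₁..t₂, h t / α t := by
  subst hγ₁ hγ₂
  have hfd : Differentiable ℝ f := hf.differentiable (by norm_num)
  have hγc : ContinuousOn γ (Set.Icc t₁ t₂) := fun t h => (hγderiv t h).continuousWithinAt
  have hc1 : ContinuousOn (fun t => α t * ‖γ' t‖ ^ 2 / (4 * M)) (Set.Icc t₁ t₂) :=
    (hαc.continuousOn.mul (hγ'cont.norm.pow 2)).div_const _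
  have hc2 : Continuous (fun t => h t / α t) := hhc.div hαc (fun t => (hαpos t).ne')
  have hi1 : IntervalIntegrable (fun t => α t * ‖γ' t‖ ^ 2 / (4 * M))
      MeasureTheory.volume t₁ t₂ :=
    ContinuousOn.intervalIntegrable_of_Icc ht.le hc1
  rw [← intervalIntegral.integral_add hi1 (hc2.intervalIntegrable _ _)]
  have key := intervalIntegral.sub_le_integral_of_hasDeriv_right_of_le
    (g := fun t => -f (γ t, t)) (g' := fun t => -(fderiv ℝ f (γ t, t) (γ' t, 1)))
    (φ := fun t => α t * ‖γ' t‖ ^ 2 / (4 * M) + h t / α t) ht.le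
    ((hf.continuous.comp_continuousOn (hγc.prodMk continuousOn_id)).neg)
    (fun t htt => by
      have h1 : HasDerivAt γ (γ' t) t :=
        (hγderiv t (Set.Ioo_subset_Icc_self htt)).hasDerivAt (Icc_mem_nhds htt.1 htt.2)
      have h2 : HasDerivAt (fun t => (γ t, t)) (γ' t, (1 : ℝ)) t := h1.prodMk (hasDerivAt_id t)
      have h3 : HasDerivAt (fun t => f (γ t, t)) (fderiv ℝ f (γ t, t) (γ' t, 1)) t :=
        HasFDerivAt.comp_hasDerivAt (f := fun t => (γ t, t)) t (hfd (γ t, t)).hasFDerivAt h2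
      exact h3.neg.hasDerivWithinAt)
    ((hc1.add hc2.continuousOn).integrableOn_Icc)
    (fun t _ => by
      have e1 : HasFDerivAt (fun y => f (y, t))
          ((fderiv ℝ f (γ t, t)).comp (ContinuousLinearMap.inl ℝ E ℝ)) (γ t) :=
        (hfd (γ t, t)).hasFDerivAt.comp (γ t) (hasFDerivAt_prodMk_left (γ t) t)
      have e2 : HasDerivAt (fun s => f (γ t, s)) (fderiv ℝ f (γ t, t) (0, 1)) t :=
        (hfd (γ t, t)).hasFDerivAt.comp_hasDerivAt t
          ((hasDerivAt_const t (γ t)).prodMk (hasDerivAt_id t))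
      have e3 : inner ℝ (gradient (fun y => f (y, t)) (γ t)) (γ' t)
          = fderiv ℝ f (γ t, t) (γ' t, 0) := by
        rw [gradient, InnerProductSpace.toDual_symm_apply, e1.fderiv]
        simp
      have e4 : fderiv ℝ f (γ t, t) (γ' t, 1)
          = fderiv ℝ f (γ t, t) (γ' t, 0) + fderiv ℝ f (γ t, t) (0, 1) := by
        rw [← map_add]; simp
      have h3 := hineq (γ t) t
      rw [e2.deriv] at h3
      have h4 := (abs_le.1 (abs_real_inner_le_norm
        (gradient (fun y => f (y, t)) (γ t)) (γ' t))).1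
      rw [e3] at h4
      show -(fderiv ℝ f (γ t, t) (γ' t, 1)) ≤ α t * ‖γ' t‖ ^ 2 / (4 * M) + h t / α t
      rw [e4]
      generalize ‖gradient (fun y => f (y, t)) (γ t)‖ = u at *
      generalize ‖γ' t‖ = w at *
      have ha := hαpos t
      have h5 : u * w + (1 / α t) * (h t - M * u ^ 2)
          = α t * w ^ 2 / (4 * M) + h t / α t - (2 * M * u - α t * w) ^ 2 / (4 * M * α t) := by
        field_simp
        ring
      have h6 : 0 ≤ (2 * M * u - α t * w) ^ 2 / (4 * M * α t) := by positivity
      linarith)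
  linarith
end

section
/- Let E be a real inner product space and let v : E × ℝ → ℝ be continuously differentiable with v(x,t) ≥ M for all (x,t), where M > 0 is a real constant. Let α, h : ℝ → ℝ be continuous with α(t) > 0 for all t, and suppose that for every x ∈ E and every t, ‖∇_x v(x,t)‖²/v(x,t) − α(t)·∂_t v(x,t)/v(x,t) − h(t) ≤ 0, where ∇_x v(x,t) denotes the gradient of the map y ↦ v(y,t) at x. Then for all real numbers t₁ < t₂, all points x₁, x₂ ∈ E, and every continuously differentiable curve γ : [t₁,t₂] → E with γ(t₁) = x₁ and γ(t₂) = x₂, one has v(x₁,t₁) ≤ v(x₂,t₂)·exp( ∫_{t₁}^{t₂} α(t)·‖γ'(t)‖²/(4M) dt + ∫_{t₁}^{t₂} h(t)/α(t) dt ). -/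
theorem harnack_pointwise_aux (V G c A D H I M : ℝ) (hM : 0 < M) (hV : M ≤ V) (hA : 0 < A)
    (hI : -(G * c) ≤ I) (hin : G ^ 2 / V - A * D / V - H ≤ 0) :
    -((I + D) / V) ≤ A * c ^ 2 / (4 * M) + H / A := by
  have hVpos : 0 < V := lt_of_lt_of_le hM hV
  have h1 : G ^ 2 - A * D - H * V ≤ 0 := by
    have : G ^ 2 / V - A * D / V - H = (G ^ 2 - A * D - H * V) / V := by
      field_simp
    rw [this] at hin
    by_contra hc
    push Not at hc
    exact absurd (div_pos hc hVpos) (not_lt.mpr hin)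
  have h2 : A * c ^ 2 / (4 * V) ≤ A * c ^ 2 / (4 * M) := by
    gcongr
  have h3 : -((I + D) / V) ≤ A * c ^ 2 / (4 * V) + H / A := by
    have e : A * c ^ 2 / (4 * V) + H / A - -((I + D) / V)
        = (A ^ 2 * c ^ 2 + 4 * H * V + 4 * A * (I + D)) / (4 * V * A) := by
      field_simp
      ring
    have : 0 ≤ (A ^ 2 * c ^ 2 + 4 * H * V + 4 * A * (I + D)) / (4 * V * A) := by
      apply div_nonneg _ (by positivity)
      nlinarith [sq_nonneg (A * c - 2 * G), mul_le_mul_of_nonneg_left hI hA.le]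
    linarith
  linarith

/-- Multiplicative Harnack inequality via curve integration: if `v : E × ℝ → ℝ`
is `C¹` with `v ≥ M > 0` and `‖∇ₓ v‖²/v - α(t) ∂ₜ v / v - h(t) ≤ 0` everywhere,
then along any `C¹` curve `γ` joining `x₁` at time `t₁` to `x₂` at time `t₂ > t₁`,
`v(x₁,t₁) ≤ v(x₂,t₂) exp(∫ α‖γ'‖²/(4M) + ∫ h/α)`. -/
theorem harnack_inequality_curve_integration
    {E : Type*} [NormedAddCommGroup E] [InnerProductSpace ℝ E] [CompleteSpace E]
    (v : E × ℝ → ℝ) (hv : ContDiff ℝ 1 v)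
    (M : ℝ) (hM : 0 < M) (hvM : ∀ (x : E) (t : ℝ), M ≤ v (x, t))
    (α h : ℝ → ℝ) (hαc : Continuous α) (hhc : Continuous h)
    (hαpos : ∀ t, 0 < α t)
    (hineq : ∀ (x : E) (t : ℝ),
      ‖gradient (fun y => v (y, t)) x‖ ^ 2 / v (x, t)
        - α t * (deriv (fun s => v (x, s)) t) / v (x, t) - h t ≤ 0)
    (t₁ t₂ : ℝ) (ht : t₁ < t₂) (x₁ x₂ : E)
    (γ γ' : ℝ → E) (hγ₁ : γ t₁ = x₁) (hγ₂ : γ t₂ = x₂)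
    (hγderiv : ∀ t ∈ Set.Icc t₁ t₂, HasDerivWithinAt γ (γ' t) (Set.Icc t₁ t₂) t)
    (hγ'cont : ContinuousOn γ' (Set.Icc t₁ t₂)) :
    v (x₁, t₁) ≤ v (x₂, t₂) *
      Real.exp ((∫ t in t₁..t₂, α t * ‖γ' t‖ ^ 2 / (4 * M))
        + ∫ t in t₁..t₂, h t / α t) := by
  have hpos : ∀ x t, 0 < v (x, t) := fun x t => lt_of_lt_of_le hM (hvM x t)
  have hγc : ContinuousOn γ (Set.Icc t₁ t₂) := fun t htt => (hγderiv t htt).continuousWithinAt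
  have hi1 : ContinuousOn (fun t => α t * ‖γ' t‖ ^ 2 / (4 * M)) (Set.Icc t₁ t₂) :=
    ((hαc.continuousOn).mul (hγ'cont.norm.pow 2)).div_const _
  have hi2 : Continuous (fun t => h t / α t) := hhc.div hαc (fun t => (hαpos t).ne')
  have hdiff : Differentiable ℝ v := hv.differentiable (by norm_num)
  have key := intervalIntegral.sub_le_integral_of_hasDeriv_right_of_le
    (g := fun t => -Real.log (v (γ t, t)))
    (g' := fun t => -((fderiv ℝ v (γ t, t) (γ' t, 1)) / v (γ t, t)))
    (φ := fun t => α t * ‖γ' t‖ ^ 2 / (4 * M) + h t / α t) ht.le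
    (by
      apply ContinuousOn.neg
      apply ContinuousOn.log
      · exact hv.continuous.comp_continuousOn (hγc.prodMk continuousOn_id)
      · exact fun t _ => (hpos _ _).ne')
    (by
      intro t htt
      have h1 : HasDerivAt γ (γ' t) t :=
        (hγderiv t (Set.Ioo_subset_Icc_self htt)).hasDerivAt (Icc_mem_nhds htt.1 htt.2)
      have h2 : HasDerivAt (fun s => (γ s, s)) (γ' t, (1 : ℝ)) t := h1.prodMk (hasDerivAt_id t)
      have h3 : HasDerivAt (fun s => v (γ s, s)) (fderiv ℝ v (γ t, t) (γ' t, 1)) t :=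
        HasFDerivAt.comp_hasDerivAt (f := fun s => (γ s, s)) t (hdiff (γ t, t)).hasFDerivAt h2
      exact ((h3.log (hpos _ _).ne').neg).hasDerivWithinAt)
    ((hi1.add hi2.continuousOn).integrableOn_Icc)
    (by
      intro t htt
      have hF := (hdiff (γ t, t)).hasFDerivAt
      have hy : HasFDerivAt (fun y => v (y, t))
          ((fderiv ℝ v (γ t, t)).comp (ContinuousLinearMap.inl ℝ E ℝ)) (γ t) :=
        hF.comp (γ t) (hasFDerivAt_prodMk_left (γ t) t)
      have hs : HasDerivAt (fun s => v (γ t, s)) (fderiv ℝ v (γ t, t) (0, 1)) t :=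
        hF.comp_hasDerivAt t ((hasDerivAt_const t (γ t)).prodMk (hasDerivAt_id t))
      have hin := hineq (γ t) t
      rw [hs.deriv] at hin
      have hI : inner ℝ (gradient (fun y => v (y, t)) (γ t)) (γ' t)
          = fderiv ℝ v (γ t, t) (γ' t, 0) := by
        rw [gradient, InnerProductSpace.toDual_symm_apply, hy.fderiv]
        simp
      have hsplit : fderiv ℝ v (γ t, t) (γ' t, 1)
          = fderiv ℝ v (γ t, t) (γ' t, 0) + fderiv ℝ v (γ t, t) (0, 1) := by
        rw [← map_add]
        simp
      have hcs := abs_real_inner_le_norm (gradient (fun y => v (y, t)) (γ t)) (γ' t)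
      rw [hI] at hcs
      simp only [hsplit]
      exact harnack_pointwise_aux _ _ _ _ _ _ _ _ hM (hvM _ _) (hαpos t) (neg_le_of_abs_le hcs) hin)
  rw [intervalIntegral.integral_add (hi1.intervalIntegrable_of_Icc ht.le)
    (hi2.intervalIntegrable _ _)] at key
  simp only [hγ₁, hγ₂] at key
  rw [← Real.log_le_log_iff (hpos _ _) (mul_pos (hpos _ _) (Real.exp_pos _)),
    Real.log_mul (hpos _ _).ne' (Real.exp_pos _).ne', Real.log_exp]
  linarith
end
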